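/- Let C and D be two sets of nonnegative integers such that C ∪ D = [0, m] \ {r} with 0 < r ≤ m/2, C ∩ D = ∅, 0 ∈ C, and R_C(n) = R_D(n) for every nonnegative integer n. Then C ∩ [0, r − 1] = A ∩ [0, r − 1] and D ∩ [0, r − 1] = B ∩ [0, r − 1]. -/

import Mathlib

/-- `R S n` is the number of pairs `(s₁, s₂)` with `s₁, s₂ ∈ S`, `s₁ < s₂` and `s₁ + s₂ = n`. -/
noncomputable def R (S : Set ℕ) (n : ℕ) : ℕ :=
  Set.ncard {p : ℕ × ℕ | p.1 ∈ S ∧ p.2 ∈ S ∧ p.1 < p.2 ∧ p.1 + p.2 = n}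

/-- `A` is the set of nonnegative integers with an even number of binary digits `1`. -/
def A : Set ℕ := {n | Even ((Nat.digits 2 n).count 1)}

/-- `B = ℕ \ A`. -/
def B : Set ℕ := Set.univ \ A

/-- `A_l = A ∩ [0, 2^l - 1]`. -/
def Aset (l : ℕ) : Set ℕ := A ∩ Set.Icc 0 (2 ^ l - 1)

/-- `B_l = B ∩ [0, 2^l - 1]`. -/
def Bset (l : ℕ) : Set ℕ := B ∩ Set.Icc 0 (2 ^ l - 1)

/-- `t + S = {t + s : s ∈ S}`. -/
def shift (t : ℕ) (S : Set ℕ) : Set ℕ := (fun s => t + s) '' S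

open Classical in
theorem R_eq_sum (S : Set ℕ) (n : ℕ) :
    (R S n : ℤ) = ∑ i ∈ Finset.range ((n + 1) / 2), if i ∈ S ∧ n - i ∈ S then (1 : ℤ) else 0 := by
  have h : {p : ℕ × ℕ | p.1 ∈ S ∧ p.2 ∈ S ∧ p.1 < p.2 ∧ p.1 + p.2 = n} =
      (fun i => (i, n - i)) ''
        ((Finset.range ((n + 1) / 2)).filter (fun i => i ∈ S ∧ n - i ∈ S) : Finset ℕ) := by
    ext ⟨a, b⟩
    simp only [Set.mem_ofPred_eq, Set.mem_image, Finset.coe_filter, Finset.mem_range,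
      Prod.mk.injEq]
    constructor
    · rintro ⟨ha, hb, hlt, hab⟩
      obtain rfl : b = n - a := by omega
      exact ⟨a, ⟨by omega, ha, hb⟩, rfl, rfl⟩
    · rintro ⟨i, ⟨hi, ha, hb⟩, rfl, rfl⟩
      exact ⟨ha, hb, by omega, by omega⟩
  rw [R, h, Set.ncard_image_of_injective _ (fun a b hab => (Prod.mk.inj hab).1),
    Set.ncard_coe_finset, Finset.card_filter]
  push_cast
  rfl

theorem sum_range_add_reflect (f : ℕ → ℤ) (k j : ℕ) :
    ∑ i ∈ Finset.range k, (f i + f (j + k - 1 - i)) =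
      ∑ i ∈ Finset.range k, f i +
        (∑ i ∈ Finset.range (j + k), f i - ∑ i ∈ Finset.range j, f i) := by
  rw [Finset.sum_add_distrib, Finset.sum_range_add, add_sub_cancel_left,
    ← Finset.sum_range_reflect (fun i => f (j + i))]
  congr 1
  refine Finset.sum_congr rfl fun i hi => ?_
  rw [Finset.mem_range] at hi
  congr 1
  omega

theorem two_mul_mem_A (k : ℕ) : 2 * k ∈ A ↔ k ∈ A := by
  rcases Nat.eq_zero_or_pos k with rfl | hk
  · simp
  · simp only [A, Set.mem_ofPred_eq]
    rw [Nat.digits_def' (by norm_num) (by omega : 0 < 2 * k)]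
    simp

theorem two_mul_add_one_mem_A (k : ℕ) : 2 * k + 1 ∈ A ↔ k ∉ A := by
  simp only [A, Set.mem_ofPred_eq]
  rw [Nat.digits_def' (by norm_num) (by omega : 0 < 2 * k + 1),
    show (2 * k + 1) % 2 = 1 by omega, show (2 * k + 1) / 2 = k by omega]
  simp [Nat.even_add_one]

theorem zero_mem_A : 0 ∈ A := by simp [A]

open Classical in
/-- If `C` and `D` partition the integers below `r` and have the same representation function,
then the signs attached to them satisfy the Thue–Morse recursion below `r`. -/
theorem mem_iff_mem_A_of_R_eq {r : ℕ} {C D : Set ℕ} (hpart : ∀ i < r, (i ∈ D ↔ i ∉ C))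
    (h0C : 0 ∈ C) (hR : ∀ n, R C n = R D n) : ∀ n < r, (n ∈ C ↔ n ∈ A) := by
  set e : ℕ → ℤ := fun i => if i ∈ C then 1 else -1 with he
  have hpairs : ∀ n < r, ∑ i ∈ Finset.range ((n + 1) / 2), (e i + e (n - i)) = 0 := by
    intro n hn
    have h : (R C n : ℤ) - R D n = 0 := by rw [hR n, sub_self]
    rw [R_eq_sum, R_eq_sum, ← Finset.sum_sub_distrib] at h
    rw [← mul_zero 2, ← h, Finset.mul_sum]
    refine Finset.sum_congr rfl fun i hi => ?_
    rw [Finset.mem_range] at hi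
    rw [hpart i (by omega), hpart (n - i) (by omega)]
    by_cases h1 : i ∈ C <;> by_cases h2 : n - i ∈ C <;> simp [he, h1, h2]
  have hodd : ∀ k, 2 * k + 1 < r → ∑ i ∈ Finset.range (2 * k + 2), e i = 0 := by
    intro k hk
    have h := hpairs _ hk
    have h' := sum_range_add_reflect e (k + 1) (k + 1)
    rw [show (2 * k + 1 + 1) / 2 = k + 1 by omega] at h
    rw [show k + 1 + (k + 1) - 1 = 2 * k + 1 by omega, h,
      show k + 1 + (k + 1) = 2 * k + 2 by omega] at h'
    linarith
  have heven : ∀ k, 2 * k < r → ∑ i ∈ Finset.range (2 * k + 1), e i = e k := by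
    intro k hk
    have h := hpairs _ hk
    have h' := sum_range_add_reflect e k (k + 1)
    rw [show (2 * k + 1) / 2 = k by omega] at h
    rw [show k + 1 + k - 1 = 2 * k by omega, h,
      show k + 1 + k = 2 * k + 1 by omega, Finset.sum_range_succ _ k] at h'
    linarith
  have he_even : ∀ k, 2 * k < r → e (2 * k) = e k := by
    intro k hk
    rcases k with _ | k
    · rfl
    · have h1 := heven _ hk
      have h2 := hodd k (by omega)
      rw [Finset.sum_range_succ, show 2 * (k + 1) = 2 * k + 2 by ring, h2] at h1
      simpa [mul_add] using h1
  have he_odd : ∀ k, 2 * k + 1 < r → e (2 * k + 1) = -e k := by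
    intro k hk
    have h1 := heven k (by omega)
    have h2 := hodd k hk
    rw [Finset.sum_range_succ, h1] at h2
    linarith
  intro n
  induction n using Nat.strong_induction_on with
  | _ n ih =>
    intro hn
    rcases Nat.eq_zero_or_pos n with rfl | hpos
    · exact iff_of_true h0C zero_mem_A
    obtain ⟨k, rfl | rfl⟩ := Nat.even_or_odd' n
    · rw [two_mul_mem_A, ← ih k (by omega) (by omega)]
      have h := he_even k hn
      by_cases h1 : 2 * k ∈ C <;> by_cases h2 : k ∈ C <;> simp [he, h1, h2] at h ⊢
    · rw [two_mul_add_one_mem_A, ← ih k (by omega) (by omega)]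
      have h := he_odd k hn
      by_cases h1 : 2 * k + 1 ∈ C <;> by_cases h2 : k ∈ C <;> simp [he, h1, h2] at h ⊢

theorem stmt_15 (m r : ℕ) (hr0 : 0 < r) (hrm : 2 * r ≤ m) (C D : Set ℕ)
    (hCD : C ∪ D = Set.Icc 0 m \ {r}) (hdisj : C ∩ D = ∅) (h0C : 0 ∈ C)
    (hR : ∀ n : ℕ, R C n = R D n) :
    C ∩ Set.Icc 0 (r - 1) = A ∩ Set.Icc 0 (r - 1) ∧
      D ∩ Set.Icc 0 (r - 1) = B ∩ Set.Icc 0 (r - 1) := by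
  have hpart : ∀ i < r, (i ∈ D ↔ i ∉ C) := by
    intro i hi
    have h1 : i ∈ C ∪ D := by
      rw [hCD]
      exact ⟨⟨by omega, by omega⟩, by simp; omega⟩
    have h2 : i ∉ C ∩ D := by simp [hdisj]
    simp only [Set.mem_union, Set.mem_inter_iff] at h1 h2
    tauto
  have hmem := mem_iff_mem_A_of_R_eq hpart h0C hR
  constructor
  · ext i
    simp only [Set.mem_inter_iff, Set.mem_Icc]
    exact and_congr_left fun hi => hmem i (by omega)
  · ext i
    simp only [Set.mem_inter_iff, Set.mem_Icc, B, Set.mem_sdiff, Set.mem_univ, true_and]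
    exact and_congr_left fun hi => by rw [hpart i (by omega), hmem i (by omega)]
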